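/- If m is a nonempty multiset of natural numbers with (card m) − (sum of the entries of m) = 1, then there exists a list w whose underlying multiset is m and which is a well-formed expression. -/

import Mathlib

/-- `C v` is the length of `v` minus the sum of its entries. -/
def C (v : List ℕ) : ℤ := (v.length : ℤ) - (v.sum : ℤ)

/-- A list of natural numbers is a well-formed expression (Polish notation
encoding of an ordered rooted tree by outdegrees) if it is of the form
`d :: (w₁ ++ ⋯ ++ w_d)` where each `wᵢ` is a well-formed expression. -/
inductive IsWF : List ℕ → Prop
  | node (d : ℕ) (ws : List (List ℕ)) (hlen : ws.length = d)
      (h : ∀ w ∈ ws, IsWF w) : IsWF (d :: ws.flatten)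

/-- The `k`-rotation of `s = u ++ v` with `v` of length `k` is `v ++ u`. -/
def krot (k : ℕ) (s : List ℕ) : List ℕ :=
  s.drop (s.length - k) ++ s.take (s.length - k)

theorem isWF_zero : IsWF [0] := by
  simpa using IsWF.node 0 [] rfl (by simp)

theorem exists_aux (p : Multiset ℕ) : (∀ x ∈ p, 0 < x) →
    ∃ z, Multiset.card p + z = p.sum + 1 ∧
      ∃ w : List ℕ, (↑w : Multiset ℕ) = p + Multiset.replicate z 0 ∧ IsWF w := by
  induction p using Multiset.induction_on with
  | empty => exact fun _ => ⟨1, by simp, [0], by simp, isWF_zero⟩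
  | cons d p ih =>
    intro h
    obtain ⟨z, hz, w, hw, hwf⟩ := ih (fun x hx => h x (Multiset.mem_cons_of_mem hx))
    have hd : 0 < d := h d (Multiset.mem_cons_self d p)
    refine ⟨z + (d - 1), ?_, d :: (w :: List.replicate (d - 1) [0]).flatten, ?_,
      IsWF.node d _ ?_ ?_⟩
    · simp only [Multiset.card_cons, Multiset.sum_cons]
      omega
    · have : (List.replicate (d - 1) [0]).flatten = List.replicate (d - 1) 0 := by
        simp
      rw [List.flatten_cons, this, ← Multiset.cons_coe, ← Multiset.coe_add, hw,
        Multiset.coe_replicate, Multiset.replicate_add, Multiset.cons_add, add_assoc]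
    · simp only [List.length_cons, List.length_replicate]
      omega
    · intro v hv
      rcases List.mem_cons.1 hv with rfl | hv
      · exact hwf
      · rw [List.eq_of_mem_replicate hv]
        exact isWF_zero

theorem stmt_1 (m : Multiset ℕ) (hm : m ≠ 0)
    (hC : (Multiset.card m : ℤ) - (m.sum : ℤ) = 1) :
    ∃ w : List ℕ, (↑w : Multiset ℕ) = m ∧ IsWF w := by
  obtain ⟨z, hz, w, hw, hwf⟩ := exists_aux (m.filter (fun x => 0 < x))
    (fun x hx => (Multiset.mem_filter.1 hx).2)
  refine ⟨w, ?_, hwf⟩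
  have hsplit := Multiset.filter_add_not (fun x => 0 < x) m
  have hrep : m.filter (fun x => ¬ 0 < x) =
      Multiset.replicate (Multiset.card (m.filter (fun x => ¬ 0 < x))) 0 := by
    rw [Multiset.eq_replicate]
    refine ⟨rfl, fun x hx => ?_⟩
    have := (Multiset.mem_filter.1 hx).2
    omega
  have hcard := congrArg Multiset.card hsplit
  have hsum := congrArg Multiset.sum hsplit
  generalize Multiset.card (m.filter (fun x => ¬ 0 < x)) = k at hrep
  rw [hrep] at hcard hsum hsplit
  simp only [Multiset.card_add, Multiset.card_replicate, Multiset.sum_add,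
    Multiset.sum_replicate, smul_zero, add_zero] at hcard hsum
  have hk : z = k := by omega
  rw [hw, hk, hsplit]
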